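/- arXiv:1002.1110 — 2 statements merged into one kernel-verified Lean document; each statement's English description precedes it below -/
import Mathlib

section
/- Let Ω ⊂ ℝ² be open, let p and q be real-valued functions on Ω with p twice continuously differentiable and p > 0 on Ω, and let u₀ be a positive twice continuously differentiable solution of div(p grad u₀) + q u₀ = 0 on Ω. Set f = p^{1/2} u₀. Then for every real-valued twice continuously differentiable function φ on Ω the following identity holds pointwise on Ω: ¼( div(p grad φ) + q φ ) = p^{1/2} ( ∂_z + (∂_z̄ f / f)·C ) ( ∂_z̄ − (∂_z̄ f / f)·C ) ( p^{1/2} φ ), where C denotes the operator of complex conjugation. -/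
open Complex

/-- Partial derivative in `x` of a complex-valued function on `ℝ²`. -/
noncomputable def pdx (f : ℝ × ℝ → ℂ) (z : ℝ × ℝ) : ℂ := fderiv ℝ f z (1, 0)

/-- Partial derivative in `y` of a complex-valued function on `ℝ²`. -/
noncomputable def pdy (f : ℝ × ℝ → ℂ) (z : ℝ × ℝ) : ℂ := fderiv ℝ f z (0, 1)

/-- The Wirtinger derivative `∂_z̄ = ½(∂_x + i∂_y)`. -/
noncomputable def dzbar (f : ℝ × ℝ → ℂ) (z : ℝ × ℝ) : ℂ :=
  (1 / 2 : ℂ) * (pdx f z + Complex.I * pdy f z)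

/-- The Wirtinger derivative `∂_z = ½(∂_x − i∂_y)`. -/
noncomputable def dz (f : ℝ × ℝ → ℂ) (z : ℝ × ℝ) : ℂ :=
  (1 / 2 : ℂ) * (pdx f z - Complex.I * pdy f z)

/-- Partial derivative in `x` of a real-valued function on `ℝ²`. -/
noncomputable def rpdx (f : ℝ × ℝ → ℝ) (z : ℝ × ℝ) : ℝ := fderiv ℝ f z (1, 0)

/-- Partial derivative in `y` of a real-valued function on `ℝ²`. -/
noncomputable def rpdy (f : ℝ × ℝ → ℝ) (z : ℝ × ℝ) : ℝ := fderiv ℝ f z (0, 1)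

/-- `div(p grad u) = ∂_x(p ∂_x u) + ∂_y(p ∂_y u)`. -/
noncomputable def divPgrad (p u : ℝ × ℝ → ℝ) (z : ℝ × ℝ) : ℝ :=
  rpdx (fun w => p w * rpdx u w) z + rpdy (fun w => p w * rpdy u w) z

/-- Coercion of a real-valued function on `ℝ²` to a complex-valued one. -/
noncomputable def cof (f : ℝ × ℝ → ℝ) : ℝ × ℝ → ℂ := fun z => ((f z : ℝ) : ℂ)

open Topology

/-- Directional derivatives of a `C²` function are differentiable. -/
lemma ContDiffAt.differentiableAt_fderiv_apply {F : ℝ × ℝ → ℝ} {z : ℝ × ℝ}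
    (hF : ContDiffAt ℝ 2 F z) (v : ℝ × ℝ) :
    DifferentiableAt ℝ (fun w => fderiv ℝ F w v) z := by
  have h1 : ContDiffAt ℝ 1 (fderiv ℝ F) z := hF.fderiv_right (by norm_num)
  exact (h1.differentiableAt one_ne_zero).clm_apply (differentiableAt_const v)

/-- A `C²` function is differentiable in a neighbourhood of the point. -/
lemma ContDiffAt.eventually_differentiableAt_of_two {F : ℝ × ℝ → ℝ} {z : ℝ × ℝ}
    (hF : ContDiffAt ℝ 2 F z) : ∀ᶠ w in 𝓝 z, DifferentiableAt ℝ F w :=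
  (hF.eventually (by simp)).mono fun _ hw => hw.differentiableAt two_ne_zero

lemma fderiv_mul_apply {F G : ℝ × ℝ → ℝ} {z : ℝ × ℝ} (hF : DifferentiableAt ℝ F z)
    (hG : DifferentiableAt ℝ G z) (v : ℝ × ℝ) :
    fderiv ℝ (fun w => F w * G w) z v = F z * fderiv ℝ G z v + G z * fderiv ℝ F z v := by
  rw [fderiv_fun_mul hF hG]
  simp

lemma hasFDerivAt_cof {F : ℝ × ℝ → ℝ} {z : ℝ × ℝ} (hF : DifferentiableAt ℝ F z) :
    HasFDerivAt (cof F) (Complex.ofRealCLM.comp (fderiv ℝ F z)) z :=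
  Complex.ofRealCLM.hasFDerivAt.comp z hF.hasFDerivAt

lemma dzbar_cof {F : ℝ × ℝ → ℝ} {z : ℝ × ℝ} (hF : DifferentiableAt ℝ F z) :
    dzbar (cof F) z = (1 / 2 : ℂ) * (rpdx F z + Complex.I * rpdy F z) := by
  simp [dzbar, pdx, pdy, rpdx, rpdy, (hasFDerivAt_cof hF).fderiv]

lemma dz_half_cof_add_I_mul_cof {A B : ℝ × ℝ → ℝ} {z : ℝ × ℝ} (hA : DifferentiableAt ℝ A z)
    (hB : DifferentiableAt ℝ B z) :
    dz (fun w => (1 / 2 : ℂ) * (cof A w + Complex.I * cof B w)) z =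
      (1 / 4 : ℂ) * ((rpdx A z + rpdy B z) + Complex.I * (rpdx B z - rpdy A z)) := by
  have h := ((hasFDerivAt_cof hA).add ((hasFDerivAt_cof hB).const_mul Complex.I)).const_mul
    (1 / 2 : ℂ)
  have h' := HasFDerivAt.fderiv (f := fun w => (1 / 2 : ℂ) * (cof A w + Complex.I * cof B w)) h
  simp only [dz, pdx, pdy, rpdx, rpdy, h']
  simp
  linear_combination (-(1 / 4 : ℂ) * (fderiv ℝ B z (0, 1) : ℂ)) * Complex.I_sq

lemma divPgrad_congr {p p' u u' : ℝ × ℝ → ℝ} {z : ℝ × ℝ} (hp : p =ᶠ[𝓝 z] p')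
    (hu : u =ᶠ[𝓝 z] u') : divPgrad p u z = divPgrad p' u' z := by
  have key (v : ℝ × ℝ) :
      (fun w => p w * fderiv ℝ u w v) =ᶠ[𝓝 z] fun w => p' w * fderiv ℝ u' w v := by
    filter_upwards [hp, hu.fderiv (𝕜 := ℝ)] with w h1 h2
    rw [h1, h2]
  simp only [divPgrad, rpdx, rpdy]
  rw [(key _).fderiv_eq, (key _).fderiv_eq]

/-- Jacobi's product formula: `div(p grad(uh)) = h div(p grad u) + u⁻¹ div(pu² grad h)`. -/
lemma divPgrad_mul {p u h : ℝ × ℝ → ℝ} {z : ℝ × ℝ} (hp : DifferentiableAt ℝ p z)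
    (hu : ContDiffAt ℝ 2 u z) (hh : ContDiffAt ℝ 2 h z) (hz : u z ≠ 0) :
    divPgrad p (fun w => u w * h w) z =
      h z * divPgrad p u z + divPgrad (fun w => p w * u w ^ 2) h z / u z := by
  have hud := hu.differentiableAt two_ne_zero
  have hhd := hh.differentiableAt two_ne_zero
  have key (v : ℝ × ℝ) :
      fderiv ℝ (fun w => p w * fderiv ℝ (fun w => u w * h w) w v) z v =
        h z * fderiv ℝ (fun w => p w * fderiv ℝ u w v) z v +
          fderiv ℝ (fun w => p w * u w ^ 2 * fderiv ℝ h w v) z v / u z := by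
    have hu' := hu.differentiableAt_fderiv_apply v
    have hh' := hh.differentiableAt_fderiv_apply v
    have e : (fun w => p w * fderiv ℝ (fun w => u w * h w) w v) =ᶠ[𝓝 z]
        fun w => p w * (u w * fderiv ℝ h w v) + p w * (h w * fderiv ℝ u w v) := by
      filter_upwards [hu.eventually_differentiableAt_of_two,
        hh.eventually_differentiableAt_of_two] with w h1 h2
      rw [fderiv_mul_apply h1 h2]
      ring
    simp only [pow_two]
    rw [e.fderiv_eq, fderiv_fun_add (hp.fun_mul (hud.fun_mul hh')) (hp.fun_mul (hhd.fun_mul hu')),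
      add_apply, fderiv_mul_apply hp (hud.fun_mul hh'), fderiv_mul_apply hud hh',
      fderiv_mul_apply hp (hhd.fun_mul hu'), fderiv_mul_apply hhd hu', fderiv_mul_apply hp hu',
      fderiv_mul_apply (hp.fun_mul (hud.fun_mul hud)) hh', fderiv_mul_apply hp (hud.fun_mul hud),
      fderiv_mul_apply hud hud]
    field_simp
    ring
  simp only [divPgrad, rpdx, rpdy]
  rw [key, key]
  ring

/-- The composition of the two Vekua-type first-order operators generated by `f`, applied to
`g = f h`, is `div(f² grad h) / (4f)`. -/
lemma vekua_factorization {f g h : ℝ × ℝ → ℝ} {z : ℝ × ℝ} (hf : ContDiffAt ℝ 2 f z)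
    (hh : ContDiffAt ℝ 2 h z) (hz : f z ≠ 0) (hg : g =ᶠ[𝓝 z] fun w => f w * h w) :
    dz (fun w => dzbar (cof g) w - dzbar (cof f) w / cof f w * (starRingEnd ℂ) (cof g w)) z +
        dzbar (cof f) z / cof f z *
          (starRingEnd ℂ)
            (dzbar (cof g) z - dzbar (cof f) z / cof f z * (starRingEnd ℂ) (cof g z)) =
      ((divPgrad (fun w => f w ^ 2) h z / (4 * f z) : ℝ) : ℂ) := by
  have hfd := hf.differentiableAt two_ne_zero
  have hx : DifferentiableAt ℝ (rpdx h) z := hh.differentiableAt_fderiv_apply (1, 0)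
  have hy : DifferentiableAt ℝ (rpdy h) z := hh.differentiableAt_fderiv_apply (0, 1)
  have e : (fun w => dzbar (cof g) w - dzbar (cof f) w / cof f w * (starRingEnd ℂ) (cof g w))
      =ᶠ[𝓝 z] fun w => (1 / 2 : ℂ) * (cof (fun w => f w * rpdx h w) w +
        Complex.I * cof (fun w => f w * rpdy h w) w) := by
    filter_upwards [hf.eventually_differentiableAt_of_two, hh.eventually_differentiableAt_of_two,
      hg.eventuallyEq_nhds, hf.continuousAt.eventually_ne hz] with w h1 h2 h3 h4
    have h4' : (f w : ℂ) ≠ 0 := by exact_mod_cast h4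
    have hgd : DifferentiableAt ℝ g w := (h1.mul h2).congr_of_eventuallyEq h3
    rw [dzbar_cof hgd, dzbar_cof h1]
    simp only [rpdx, rpdy, cof, h3.fderiv_eq, h3.eq_of_nhds, fderiv_mul_apply h1 h2,
      Complex.conj_ofReal]
    push_cast
    field_simp
    ring
  have hsymm : rpdx (rpdy h) z = rpdy (rpdx h) z := by
    have hd : DifferentiableAt ℝ (fderiv ℝ h) z :=
      (hh.fderiv_right (m := 1) (by norm_num)).differentiableAt one_ne_zero
    have hs := (hh.isSymmSndFDerivAt (by simp)).eq (1, 0) (0, 1)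
    unfold rpdx rpdy
    rw [fderiv_clm_apply hd (differentiableAt_const _),
      fderiv_clm_apply hd (differentiableAt_const _)]
    simpa using hs
  have hz' : (f z : ℂ) ≠ 0 := by exact_mod_cast hz
  have hdz : dz (fun w => dzbar (cof g) w -
      dzbar (cof f) w / cof f w * (starRingEnd ℂ) (cof g w)) z =
      dz (fun w => (1 / 2 : ℂ) * (cof (fun w => f w * rpdx h w) w +
        Complex.I * cof (fun w => f w * rpdy h w) w)) z := by
    simp only [dz, pdx, pdy, e.fderiv_eq]
  have hval := e.eq_of_nhds
  have hdiv : divPgrad (fun w => f w ^ 2) h z =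
      f z ^ 2 * (rpdx (rpdx h) z + rpdy (rpdy h) z) +
        2 * f z * (rpdx f z * rpdx h z + rpdy f z * rpdy h z) := by
    have hx' (v : ℝ × ℝ) := fderiv_mul_apply (hfd.fun_mul hfd) hx v
    have hy' (v : ℝ × ℝ) := fderiv_mul_apply (hfd.fun_mul hfd) hy v
    have hff (v : ℝ × ℝ) := fderiv_mul_apply hfd hfd v
    rw [divPgrad, rpdx, rpdy]
    simp only [pow_two]
    rw [hx', hy', hff, hff]
    simp only [rpdx, rpdy]
    ring
  have hA (v : ℝ × ℝ) := fderiv_mul_apply hfd hx v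
  have hB (v : ℝ × ℝ) := fderiv_mul_apply hfd hy v
  have hAx : rpdx (fun w => f w * rpdx h w) z = f z * rpdx (rpdx h) z + rpdx h z * rpdx f z :=
    hA _
  have hAy : rpdy (fun w => f w * rpdx h w) z = f z * rpdy (rpdx h) z + rpdx h z * rpdy f z :=
    hA _
  have hBx : rpdx (fun w => f w * rpdy h w) z = f z * rpdx (rpdy h) z + rpdy h z * rpdx f z :=
    hB _
  have hBy : rpdy (fun w => f w * rpdy h w) z = f z * rpdy (rpdy h) z + rpdy h z * rpdy f z :=
    hB _
  rw [hdz, dz_half_cof_add_I_mul_cof (hfd.fun_mul hx) (hfd.fun_mul hy), hval,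
    dzbar_cof hfd, hdiv, hAx, hAy, hBx, hBy, hsymm]
  simp only [cof, map_mul, map_add, Complex.conj_ofReal, Complex.conj_I, map_div₀, map_one,
    map_ofNat]
  push_cast
  field_simp
  ring_nf
  simp only [Complex.I_sq]
  ring

/-- factorization of `div p grad + q`. If `u₀` is a positive solution of
`div(p grad u₀) + q u₀ = 0` on `Ω`, `f = p^{1/2} u₀`, then for every real-valued `C²`
function `φ`,
`¼(div(p grad φ) + qφ) = p^{1/2}(∂_z + (f_z̄/f)C)(∂_z̄ − (f_z̄/f)C)(p^{1/2} φ)` on `Ω`. -/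
theorem statement1 (Ω : Set (ℝ × ℝ)) (hΩ : IsOpen Ω)
    (p q u₀ : ℝ × ℝ → ℝ)
    (hp : ContDiffOn ℝ 2 p Ω) (hppos : ∀ z ∈ Ω, 0 < p z)
    (hu₀ : ContDiffOn ℝ 2 u₀ Ω) (hu₀pos : ∀ z ∈ Ω, 0 < u₀ z)
    (hu₀sol : ∀ z ∈ Ω, divPgrad p u₀ z + q z * u₀ z = 0)
    (f : ℝ × ℝ → ℝ) (hf : ∀ z, f z = Real.sqrt (p z) * u₀ z)
    (φ : ℝ × ℝ → ℝ) (hφ : ContDiffOn ℝ 2 φ Ω) :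
    ∀ z ∈ Ω,
      ((divPgrad p φ z + q z * φ z : ℝ) : ℂ) / 4 =
        ((Real.sqrt (p z) : ℝ) : ℂ) *
          (dz (fun w => dzbar (cof (fun v => Real.sqrt (p v) * φ v)) w -
                dzbar (cof f) w / (cof f w) *
                  (starRingEnd ℂ) (cof (fun v => Real.sqrt (p v) * φ v) w)) z +
            dzbar (cof f) z / (cof f z) *
              (starRingEnd ℂ)
                (dzbar (cof (fun v => Real.sqrt (p v) * φ v)) z -
                  dzbar (cof f) z / (cof f z) *
                    (starRingEnd ℂ) (cof (fun v => Real.sqrt (p v) * φ v) z))) := by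
  intro z hz
  have hΩz : Ω ∈ 𝓝 z := hΩ.mem_nhds hz
  have hpz := hp.contDiffAt hΩz
  have huz := hu₀.contDiffAt hΩz
  have hφz := hφ.contDiffAt hΩz
  have hs0 : 0 < Real.sqrt (p z) := Real.sqrt_pos.2 (hppos z hz)
  have hu0 := hu₀pos z hz
  have hfz : ContDiffAt ℝ 2 f z := by
    rw [funext hf]
    exact (hpz.sqrt (hppos z hz).ne').mul huz
  have hfz0 : f z ≠ 0 := by
    rw [hf]
    positivity
  have hh : ContDiffAt ℝ 2 (fun w => φ w / u₀ w) z := hφz.div huz hu0.ne'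
  have hg : (fun v => Real.sqrt (p v) * φ v) =ᶠ[𝓝 z] fun w => f w * (φ w / u₀ w) := by
    filter_upwards [hΩz] with w hw
    have := (hu₀pos w hw).ne'
    rw [hf]
    field_simp
  have hφe : φ =ᶠ[𝓝 z] fun w => u₀ w * (φ w / u₀ w) := by
    filter_upwards [hΩz] with w hw
    have := (hu₀pos w hw).ne'
    field_simp
  have hfe : (fun w => f w ^ 2) =ᶠ[𝓝 z] fun w => p w * u₀ w ^ 2 := by
    filter_upwards [hΩz] with w hw
    rw [hf, mul_pow, Real.sq_sqrt (hppos w hw).le]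
  rw [vekua_factorization hfz hh hfz0 hg, divPgrad_congr hfe .rfl,
    divPgrad_congr (.refl _ p) hφe,
    divPgrad_mul (hpz.differentiableAt two_ne_zero) huz hh hu0.ne',
    eq_neg_of_add_eq_zero_left (hu₀sol z hz), hf z]
  norm_cast
  field_simp
  ring
end

section
/- Let Ω ⊂ ℝ² be open, let p and q be real-valued functions on Ω with p twice continuously differentiable and p > 0 on Ω, let u₀ be a positive twice continuously differentiable solution of div(p grad u₀) + q u₀ = 0 on Ω, and set f = p^{1/2} u₀. Let W = W₁ + iW₂ be a twice continuously differentiable complex-valued solution of the main Vekua equation ∂_z̄ W = (∂_z̄ f / f)·conj(W) on Ω, with W₁ = Re W and W₂ = Im W. Then u = p^{−1/2} W₁ satisfies div(p grad u) + q u = 0 on Ω. -/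
open Complex

theorem ContDiffOn.differentiableAt_fderiv_apply {E F : Type*} [NormedAddCommGroup E]
    [NormedSpace ℝ E] [NormedAddCommGroup F] [NormedSpace ℝ F] {Ω : Set E} (hΩ : IsOpen Ω)
    {g : E → F} (hg : ContDiffOn ℝ 2 g Ω) {z : E} (hz : z ∈ Ω) (v : E) :
    DifferentiableAt ℝ (fun w => fderiv ℝ g w v) z := by
  have h : DifferentiableAt ℝ (fderiv ℝ g) z :=
    ((hg.contDiffAt (hΩ.mem_nhds hz)).fderiv_right (m := 1) (by norm_num)).differentiableAt
      (by norm_num)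
  exact h.clm_apply (differentiableAt_const v)

theorem ContDiffOn.fderiv_fderiv_apply_comm {E F : Type*} [NormedAddCommGroup E]
    [NormedSpace ℝ E] [NormedAddCommGroup F] [NormedSpace ℝ F] {Ω : Set E} (hΩ : IsOpen Ω)
    {g : E → F} (hg : ContDiffOn ℝ 2 g Ω) {z : E} (hz : z ∈ Ω) (v w : E) :
    fderiv ℝ (fun x => fderiv ℝ g x v) z w = fderiv ℝ (fun x => fderiv ℝ g x w) z v := by
  have hc := hg.contDiffAt (hΩ.mem_nhds hz)
  have h : DifferentiableAt ℝ (fderiv ℝ g) z :=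
    (hc.fderiv_right (m := 1) (by norm_num)).differentiableAt (by norm_num)
  rw [fderiv_clm_apply h (differentiableAt_const v), fderiv_clm_apply h (differentiableAt_const w)]
  simpa using (hc.isSymmSndFDerivAt (by simp)).eq w v

/-- Lagrange's identity in the direction `v`. -/
theorem fderiv_lagrange_identity {E : Type*} [NormedAddCommGroup E] [NormedSpace ℝ E]
    {Ω : Set E} (hΩ : IsOpen Ω) {p u u₀ : E → ℝ} (hp : ContDiffOn ℝ 2 p Ω)
    (hu : ContDiffOn ℝ 2 u Ω) (hu₀ : ContDiffOn ℝ 2 u₀ Ω) {z : E} (hz : z ∈ Ω) (v : E) :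
    fderiv ℝ (fun w => u₀ w * (p w * fderiv ℝ u w v) - u w * (p w * fderiv ℝ u₀ w v)) z v =
      u₀ z * fderiv ℝ (fun w => p w * fderiv ℝ u w v) z v -
        u z * fderiv ℝ (fun w => p w * fderiv ℝ u₀ w v) z v := by
  have hd {g : E → ℝ} (hg : ContDiffOn ℝ 2 g Ω) : DifferentiableAt ℝ g z :=
    (hg.contDiffAt (hΩ.mem_nhds hz)).differentiableAt (by norm_num)
  have hP := (hd hp).fun_mul (hu.differentiableAt_fderiv_apply hΩ hz v)
  have hQ := (hd hp).fun_mul (hu₀.differentiableAt_fderiv_apply hΩ hz v)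
  rw [fderiv_fun_sub ((hd hu₀).fun_mul hP) ((hd hu).fun_mul hQ), fderiv_fun_mul (hd hu₀) hP,
    fderiv_fun_mul (hd hu) hQ]
  simp only [sub_apply, add_apply, smul_apply, smul_eq_mul]
  ring

theorem fderiv_re_apply {E : Type*} [NormedAddCommGroup E] [NormedSpace ℝ E] {W : E → ℂ} {z : E}
    (hW : DifferentiableAt ℝ W z) (v : E) :
    fderiv ℝ (fun w => (W w).re) z v = (fderiv ℝ W z v).re :=
  DFunLike.congr_fun (Complex.reCLM.hasFDerivAt.comp z hW.hasFDerivAt).fderiv v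

theorem fderiv_im_apply {E : Type*} [NormedAddCommGroup E] [NormedSpace ℝ E] {W : E → ℂ} {z : E}
    (hW : DifferentiableAt ℝ W z) (v : E) :
    fderiv ℝ (fun w => (W w).im) z v = (fderiv ℝ W z v).im :=
  DFunLike.congr_fun (Complex.imCLM.hasFDerivAt.comp z hW.hasFDerivAt).fderiv v

theorem fderiv_cof_apply {f : ℝ × ℝ → ℝ} {z : ℝ × ℝ} (hf : DifferentiableAt ℝ f z) (v : ℝ × ℝ) :
    fderiv ℝ (cof f) z v = ((fderiv ℝ f z v : ℝ) : ℂ) :=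
  DFunLike.congr_fun (Complex.ofRealCLM.hasFDerivAt.comp z hf.hasFDerivAt).fderiv v

/-- Real and imaginary parts of the main Vekua equation, multiplied by `f`. -/
theorem vekua_re_im {f : ℝ × ℝ → ℝ} {W : ℝ × ℝ → ℂ} {z : ℝ × ℝ} (hf : DifferentiableAt ℝ f z)
    (hW : DifferentiableAt ℝ W z) (hfz : f z ≠ 0)
    (h : dzbar W z = dzbar (cof f) z / (cof f z) * (starRingEnd ℂ) (W z)) :
    f z * rpdx (fun w => (W w).re) z - (W z).re * rpdx f z
        = rpdy (fun w => f w * (W w).im) z ∧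
      f z * rpdy (fun w => (W w).re) z - (W z).re * rpdy f z
        = -rpdx (fun w => f w * (W w).im) z := by
  have hi : DifferentiableAt ℝ (fun w => (W w).im) z :=
    Complex.imCLM.differentiableAt.comp z hW
  have hfz' : ((f z : ℝ) : ℂ) ≠ 0 := by exact_mod_cast hfz
  have h' : (f z : ℂ) * (pdx W z + Complex.I * pdy W z) =
      (rpdx f z + Complex.I * rpdy f z) * (starRingEnd ℂ) (W z) := by
    simp only [dzbar] at h
    rw [show pdx (cof f) z = rpdx f z from fderiv_cof_apply hf _,
      show pdy (cof f) z = rpdy f z from fderiv_cof_apply hf _,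
      show cof f z = (f z : ℂ) from rfl] at h
    field_simp at h
    linear_combination h
  have hre := congrArg Complex.re h'
  have him := congrArg Complex.im h'
  simp at hre him
  simp only [rpdx, rpdy, pdx, pdy, fderiv_fun_mul hf hi, fderiv_re_apply hW, add_apply,
    smul_apply, smul_eq_mul, fderiv_im_apply hW] at hre him ⊢
  constructor
  · linear_combination hre
  · linear_combination him

/-- The flux `p (u₀ ∇u - u ∇u₀)` is unchanged, with weight `1`, after multiplying `u` and `u₀`
by a square root of `p`. -/
theorem flux_mul {E : Type*} [NormedAddCommGroup E] [NormedSpace ℝ E] {s u u₀ : E → ℝ} {z : E}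
    (hs : DifferentiableAt ℝ s z) (hu : DifferentiableAt ℝ u z) (hu₀ : DifferentiableAt ℝ u₀ z)
    (v : E) :
    s z * u₀ z * fderiv ℝ (fun w => s w * u w) z v -
        s z * u z * fderiv ℝ (fun w => s w * u₀ w) z v =
      u₀ z * (s z ^ 2 * fderiv ℝ u z v) - u z * (s z ^ 2 * fderiv ℝ u₀ z v) := by
  simp only [fderiv_fun_mul hs hu, fderiv_fun_mul hs hu₀, add_apply,
    smul_apply, smul_eq_mul]
  ring

/-- if `W` solves the main Vekua equation `∂_z̄ W = (∂_z̄ f/f)·conj W`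
with `f = p^{1/2}u₀`, then `u = p^{−1/2}·Re W` solves `div(p grad u) + qu = 0` on `Ω`. -/
theorem statement3 (Ω : Set (ℝ × ℝ)) (hΩ : IsOpen Ω)
    (p q u₀ : ℝ × ℝ → ℝ)
    (hp : ContDiffOn ℝ 2 p Ω) (hppos : ∀ z ∈ Ω, 0 < p z)
    (hu₀ : ContDiffOn ℝ 2 u₀ Ω) (hu₀pos : ∀ z ∈ Ω, 0 < u₀ z)
    (hu₀sol : ∀ z ∈ Ω, divPgrad p u₀ z + q z * u₀ z = 0)
    (f : ℝ × ℝ → ℝ) (hf : ∀ z, f z = Real.sqrt (p z) * u₀ z)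
    (W : ℝ × ℝ → ℂ) (hW : ContDiffOn ℝ 2 W Ω)
    (hVekua : ∀ z ∈ Ω, dzbar W z = dzbar (cof f) z / (cof f z) * (starRingEnd ℂ) (W z)) :
    ∀ z ∈ Ω,
      divPgrad p (fun w => (Real.sqrt (p w))⁻¹ * (W w).re) z +
        q z * ((Real.sqrt (p z))⁻¹ * (W z).re) = 0 := by
  intro z hz
  obtain rfl : f = fun w => Real.sqrt (p w) * u₀ w := funext hf
  set u : ℝ × ℝ → ℝ := fun w => (Real.sqrt (p w))⁻¹ * (W w).re with hu_def
  have hs : ContDiffOn ℝ 2 (fun w => Real.sqrt (p w)) Ω := hp.sqrt fun w hw => (hppos w hw).ne'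
  have hs0 {w} (hw : w ∈ Ω) : Real.sqrt (p w) ≠ 0 := (Real.sqrt_pos.2 (hppos w hw)).ne'
  have hre : ContDiffOn ℝ 2 (fun w => (W w).re) Ω := Complex.reCLM.contDiff.comp_contDiffOn hW
  have him : ContDiffOn ℝ 2 (fun w => (W w).im) Ω := Complex.imCLM.contDiff.comp_contDiffOn hW
  have hu : ContDiffOn ℝ 2 u Ω := (hs.inv fun w hw => hs0 hw).mul hre
  have hV : ContDiffOn ℝ 2 (fun w => Real.sqrt (p w) * u₀ w * (W w).im) Ω := (hs.mul hu₀).mul him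
  have hd {F : Type} [NormedAddCommGroup F] [NormedSpace ℝ F] {g : ℝ × ℝ → F}
      (hg : ContDiffOn ℝ 2 g Ω) {w} (hw : w ∈ Ω) : DifferentiableAt ℝ g w :=
    (hg.contDiffAt (hΩ.mem_nhds hw)).differentiableAt (by norm_num)
  have hsu {w} (hw : w ∈ Ω) : (W w).re = Real.sqrt (p w) * u w := by
    simp [hu_def, mul_inv_cancel_left₀ (hs0 hw)]
  have hflux {w} (hw : w ∈ Ω) (v : ℝ × ℝ) :
      u₀ w * (p w * fderiv ℝ u w v) - u w * (p w * fderiv ℝ u₀ w v) =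
        Real.sqrt (p w) * u₀ w * fderiv ℝ (fun w => (W w).re) w v -
          (W w).re * fderiv ℝ (fun w => Real.sqrt (p w) * u₀ w) w v := by
    have heq : (fun w => (W w).re) =ᶠ[nhds w] fun w => Real.sqrt (p w) * u w := by
      filter_upwards [hΩ.mem_nhds hw] with x hx using hsu hx
    rw [heq.fderiv_eq, hsu hw, flux_mul (hd hs hw) (hd hu hw) (hd hu₀ hw),
      Real.sq_sqrt (hppos w hw).le]
  have hvek {w} (hw : w ∈ Ω) := vekua_re_im (hd (hs.mul hu₀) hw) (hd hW hw)
    (mul_ne_zero (hs0 hw) (hu₀pos w hw).ne') (hVekua w hw)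
  have hx := fderiv_lagrange_identity hΩ hp hu hu₀ hz (1, 0)
  have hy := fderiv_lagrange_identity hΩ hp hu hu₀ hz (0, 1)
  have ex : (fun w => u₀ w * (p w * fderiv ℝ u w (1, 0)) - u w * (p w * fderiv ℝ u₀ w (1, 0)))
      =ᶠ[nhds z] fun w => fderiv ℝ (fun w => Real.sqrt (p w) * u₀ w * (W w).im) w (0, 1) := by
    filter_upwards [hΩ.mem_nhds hz] with w hw using (hflux hw _).trans (hvek hw).1
  have ey : (fun w => u₀ w * (p w * fderiv ℝ u w (0, 1)) - u w * (p w * fderiv ℝ u₀ w (0, 1)))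
      =ᶠ[nhds z] fun w => -fderiv ℝ (fun w => Real.sqrt (p w) * u₀ w * (W w).im) w (1, 0) := by
    filter_upwards [hΩ.mem_nhds hz] with w hw using (hflux hw _).trans (hvek hw).2
  rw [ex.fderiv_eq, hV.fderiv_fderiv_apply_comm hΩ hz] at hx
  rw [ey.fderiv_eq, fderiv_fun_neg, neg_apply] at hy
  have h0 := hu₀sol z hz
  simp only [divPgrad, rpdx, rpdy] at h0 ⊢
  refine (mul_eq_zero.1 ?_).resolve_left (hu₀pos z hz).ne'
  change u₀ z * (_ + q z * u z) = 0
  linear_combination u z * h0 - hx - hy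
end
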